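/- Let ζ ∈ ∂Δ (|ζ| = 1), p ∈ Γ⁰, and g = (g₁,…,gₙ) ∈ ℂⁿ, and let G be the real 1-form on ℂⁿ given by G(v) = 2 Re(Σ_i g_i v^i). Define the real 1-form ζ·dρ⁰_p by (ζ·dρ⁰_p)(v) = Re(ζ)·dρ⁰_p(v) + Im(ζ)·dρ⁰_p(J⁰_p(v)). Then there exists λ ∈ ℝ∖{0} with G = λ·(ζ·dρ⁰_p) if and only if ζ̄·gₙ is a nonzero real number and, for every 1 ≤ α ≤ n−1, g_α + (conj(p^α) + (i/2)·Σ_β conj(A_{ᾱβ̄})·p^β)·gₙ − (i/2)·Σ_β conj(A_{ᾱβ̄})·p^β·conj(gₙ) = 0; and in that case λ = 𝜁̄·gₙ. -/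

import Mathlib

open Complex ComplexConjugate Finset

noncomputable section

/-- Standard complex structure of `ℂⁿ`: multiplication by `i`. -/
def Jstd (n : ℕ) : (Fin n → ℂ) →L[ℝ] (Fin n → ℂ) :=
  Complex.I • ContinuousLinearMap.id ℝ (Fin n → ℂ)

/-- The functional `v ↦ Σ_{α,β} A_{ᾱβ̄} z̄^β conj(v^α)` used in the osculating structure. -/
def oscCoeff (n : ℕ) (A : Fin n → Fin n → ℂ) (z : Fin (n+1) → ℂ) :
    (Fin (n+1) → ℂ) →L[ℝ] ℂ :=
  ∑ α : Fin n, ∑ β : Fin n,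
    (A α β * conj (z β.castSucc)) •
      (Complex.conjCLE.toContinuousLinearMap.comp
        (ContinuousLinearMap.proj α.castSucc : (Fin (n+1) → ℂ) →L[ℝ] ℂ))

/-- The osculating almost complex structure `J⁰` on `ℂ^{n+1}` with coefficients `A`. -/
def Josc (n : ℕ) (A : Fin n → Fin n → ℂ) (z : Fin (n+1) → ℂ) :
    (Fin (n+1) → ℂ) →L[ℝ] (Fin (n+1) → ℂ) :=
  Jstd (n+1) + (oscCoeff n A z).smulRight (Pi.single (Fin.last n) 1)

/-- The differential of `ρ⁰` at `p`: `dρ⁰_p(v) = 2 Re(vⁿ − Σ_α conj(p^α) v^α)`. -/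
def drho0 (n : ℕ) (p v : Fin (n+1) → ℂ) : ℝ :=
  2 * (v (Fin.last n) - ∑ α : Fin n, conj (p α.castSucc) * v α.castSucc).re

/-- The rotated 1-form `ζ·dρ⁰_p` for the structure `J⁰`:
`(ζ·dρ⁰_p)(v) = Re(ζ)·dρ⁰_p(v) + Im(ζ)·dρ⁰_p(J⁰_p(v))`. -/
def zetaDrho0 (n : ℕ) (A : Fin n → Fin n → ℂ) (ζ : ℂ) (p v : Fin (n+1) → ℂ) : ℝ :=
  ζ.re * drho0 n p v + ζ.im * drho0 n p (Josc n A p v)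

/-- The complex covector `c` representing `ζ·dρ⁰_p` through `v ↦ 2 Re(Σ_i c_i v^i)`. -/
def zetaCovector (n : ℕ) (A : Fin n → Fin n → ℂ) (ζ : ℂ) (p : Fin (n+1) → ℂ) :
    Fin (n+1) → ℂ :=
  Fin.snoc (α := fun _ => ℂ)
    (fun α => -(ζ * conj (p α.castSucc)) +
      (ζ.im : ℂ) * ∑ β : Fin n, conj (A α β) * p β.castSucc) ζ

theorem re_oscCoeff (n : ℕ) (A : Fin n → Fin n → ℂ) (p v : Fin (n+1) → ℂ) :
    (oscCoeff n A p v).re =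
      (∑ α : Fin n, (∑ β : Fin n, conj (A α β) * p β.castSucc) * v α.castSucc).re := by
  rw [← Complex.conj_re]
  congr 1
  simp [oscCoeff, Finset.sum_mul]

theorem zetaDrho0_eq_re_sum (n : ℕ) (A : Fin n → Fin n → ℂ) (ζ : ℂ)
    (p v : Fin (n+1) → ℂ) :
    zetaDrho0 n A ζ p v = 2 * (∑ i, zetaCovector n A ζ p i * v i).re := by
  have hlast : Josc n A p v (Fin.last n) = I * v (Fin.last n) + oscCoeff n A p v := by
    simp [Josc, Jstd]
  have hcast (α : Fin n) : Josc n A p v α.castSucc = I * v α.castSucc := by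
    simp [Josc, Jstd, (Fin.castSucc_lt_last α).ne]
  have hsum : ∑ i, zetaCovector n A ζ p i * v i =
      ζ * (v (Fin.last n) - ∑ α : Fin n, conj (p α.castSucc) * v α.castSucc) +
      (ζ.im : ℂ) *
        ∑ α : Fin n, (∑ β : Fin n, conj (A α β) * p β.castSucc) * v α.castSucc := by
    simp only [Fin.sum_univ_castSucc, zetaCovector, Fin.snoc_castSucc, Fin.snoc_last]
    generalize ht : (fun α : Fin n => ∑ β : Fin n, conj (A α β) * p β.castSucc) = t
    simp only [funext_iff] at ht
    simp only [ht]
    simp only [add_mul,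
      Finset.sum_add_distrib, mul_sub, Finset.mul_sum, neg_mul, Finset.sum_neg_distrib, mul_assoc]
    ring
  have hI : ∑ α : Fin n, conj (p α.castSucc) * (I * v α.castSucc) =
      I * ∑ α : Fin n, conj (p α.castSucc) * v α.castSucc := by
    rw [Finset.mul_sum]
    exact Finset.sum_congr rfl fun α _ => by ring
  simp only [zetaDrho0, drho0, hlast, hcast, hsum, hI, add_re, sub_re, re_oscCoeff, mul_re,
    I_re, I_im, ofReal_re, ofReal_im, sub_im]
  ring

theorem two_mul_re_sum_eq_iff {ι : Type*} [Fintype ι] (g c : ι → ℂ) (r : ℝ) :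
    (∀ v : ι → ℂ, 2 * (∑ i, g i * v i).re = r * (2 * (∑ i, c i * v i).re)) ↔
      ∀ i, g i = r * c i := by
  classical
  refine ⟨fun h i => ?_, fun h v => ?_⟩
  · have h1 := h (Pi.single i 1)
    have h2 := h (Pi.single i I)
    simp only [Pi.single_apply, mul_ite, mul_zero, mul_one, Finset.sum_ite_eq',
      Finset.mem_univ, if_true, mul_I_re] at h1 h2
    apply Complex.ext
    · rw [re_ofReal_mul]; linarith
    · rw [im_ofReal_mul]; linarith
  · simp only [h, mul_assoc, ← Finset.mul_sum, re_ofReal_mul]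
    ring

/-- characterization of the covectors proportional to `ζ·dρ⁰_p`, giving the
boundary condition for lifts of stationary discs, together with the value of the factor
`λ = ζ̄·gₙ`. -/
theorem stmt12 (n : ℕ) (hn : 1 ≤ n) (A : Fin n → Fin n → ℂ)
    (hA : ∀ α β, A α β = - A β α)
    (ζ : ℂ) (hζ : ‖ζ‖ = 1)
    (p : Fin (n+1) → ℂ)
    (hp : 2 * (p (Fin.last n)).re = ∑ α : Fin n, Complex.normSq (p α.castSucc))
    (g : Fin (n+1) → ℂ) :
    ((∃ lam : ℝ, lam ≠ 0 ∧ ∀ v : Fin (n+1) → ℂ,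
        2 * (∑ i, g i * v i).re = lam * zetaDrho0 n A ζ p v) ↔
      ((conj ζ * g (Fin.last n)).im = 0 ∧ conj ζ * g (Fin.last n) ≠ 0 ∧
        ∀ α : Fin n,
          g α.castSucc +
            (conj (p α.castSucc) +
              (Complex.I / 2) * ∑ β : Fin n, conj (A α β) * p β.castSucc) *
              g (Fin.last n) -
            (Complex.I / 2) * (∑ β : Fin n, conj (A α β) * p β.castSucc) *
              conj (g (Fin.last n)) = 0)) ∧
    (∀ lam : ℝ, lam ≠ 0 →
      (∀ v : Fin (n+1) → ℂ, 2 * (∑ i, g i * v i).re = lam * zetaDrho0 n A ζ p v) →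
      (lam : ℂ) = conj ζ * g (Fin.last n)) := by
  have hζ' : conj ζ * ζ = 1 := by
    rw [mul_comm, mul_conj, normSq_eq_norm_sq, hζ]; simp
  have hform (r : ℝ) : (∀ v : Fin (n+1) → ℂ,
      2 * (∑ i, g i * v i).re = r * zetaDrho0 n A ζ p v) ↔
      g (Fin.last n) = r * ζ ∧ ∀ α : Fin n, g α.castSucc =
        r * (-(ζ * conj (p α.castSucc)) +
          (ζ.im : ℂ) * ∑ β : Fin n, conj (A α β) * p β.castSucc) := by
    simp only [zetaDrho0_eq_re_sum, two_mul_re_sum_eq_iff, Fin.forall_fin_succ', zetaCovector,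
      Fin.snoc_castSucc, Fin.snoc_last]
    exact and_comm
  have hfactor (r : ℝ) (h : g (Fin.last n) = r * ζ) :
      conj ζ * g (Fin.last n) = r := by
    rw [h, mul_left_comm, hζ', mul_one]
  have him : (ζ.im : ℂ) = -(I / 2) * (ζ - conj ζ) := by
    rw [sub_conj]
    push_cast
    linear_combination (ζ.im : ℂ) * I_sq
  refine ⟨⟨?_, ?_⟩, fun r _ h => (hfactor r ((hform r).1 h).1).symm⟩
  · rintro ⟨r, hr, h⟩
    obtain ⟨hl, hc⟩ := (hform r).1 h
    refine ⟨by rw [hfactor r hl, ofReal_im], by rw [hfactor r hl]; exact_mod_cast hr,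
      fun α => ?_⟩
    rw [hc, hl, him, map_mul, conj_ofReal]
    ring
  · rintro ⟨hreal, hne, hc⟩
    have hr : ((conj ζ * g (Fin.last n)).re : ℂ) = conj ζ * g (Fin.last n) :=
      Complex.ext (by simp only [ofReal_re]) (by simp only [ofReal_im, hreal])
    generalize (conj ζ * g (Fin.last n)).re = r at hr
    have hl : g (Fin.last n) = r * ζ := by
      rw [hr]
      linear_combination (-g (Fin.last n)) * hζ'
    refine ⟨r, fun h0 => hne (by rw [← hr, h0, ofReal_zero]), (hform r).2 ⟨hl, fun α => ?_⟩⟩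
    have h := hc α
    rw [hl, map_mul, conj_ofReal] at h
    rw [him]
    linear_combination h
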